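/- Let p be a prime and U ⊆ F_p^2 with (n - 1)·p < #U ≤ n·p for some n ∈ ℕ. Write H_{U,n}(x, y) = x^{np} + G_1(x, y)·x^{(n-1)p} + ⋯ + G_n(x, y), where each G_j has x-degree strictly less than p. Let D* (respectively E*) be the number of non-vertical U-special (respectively U-rich) directions, i.e. those lying in F_p, and set D† := max(D*, 1) and E† := max(E*, 1). Then for all 1 ≤ j ≤ n, the x-degree of G_j is at most E† + (j - 1)·D†. -/

import Mathlib

open Finset Polynomial

attribute [local instance] Classical.propDecidable

/-- The line in `(ZMod p)²` with slope `m` (where `none` denotes the vertical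
slope `∞`) and "intercept" `c`. -/
noncomputable def lineWithSlope (p : ℕ) [NeZero p] (m : Option (ZMod p)) (c : ZMod p) :
    Finset (ZMod p × ZMod p) :=
  match m with
  | some m => Finset.univ.filter fun q => q.2 = m * q.1 + c
  | none => Finset.univ.filter fun q => q.1 = c

/-- `ℓ` is `U`-rich: it meets `U` in at least `#U/p + 1` points. -/
def IsRich (p : ℕ) (U ℓ : Finset (ZMod p × ZMod p)) : Prop :=
  (U.card : ℚ) / p + 1 ≤ ((ℓ ∩ U).card : ℚ)

/-- `ℓ` is `U`-poor: it meets `U` in at most `#U/p - 1` points. -/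
def IsPoor (p : ℕ) (U ℓ : Finset (ZMod p × ZMod p)) : Prop :=
  ((ℓ ∩ U).card : ℚ) ≤ (U.card : ℚ) / p - 1

/-- `m` is a `U`-rich direction: some line with slope `m` is `U`-rich. -/
def IsRichDir (p : ℕ) [NeZero p] (U : Finset (ZMod p × ZMod p))
    (m : Option (ZMod p)) : Prop :=
  ∃ c : ZMod p, IsRich p U (lineWithSlope p m c)

/-- `m` is a `U`-special direction: some line with slope `m` is `U`-rich or `U`-poor. -/
def IsSpecialDir (p : ℕ) [NeZero p] (U : Finset (ZMod p × ZMod p))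
    (m : Option (ZMod p)) : Prop :=
  ∃ c : ZMod p, IsRich p U (lineWithSlope p m c) ∨ IsPoor p U (lineWithSlope p m c)

/-- The Rédei polynomial of `U`, as a polynomial in `x` over `F_p[y]`. -/
noncomputable def redei (p : ℕ) (U : Finset (ZMod p × ZMod p)) :
    Polynomial (Polynomial (ZMod p)) :=
  ∏ q ∈ U, (Polynomial.X - Polynomial.C (Polynomial.C q.1 * Polynomial.X)
      + Polynomial.C (Polynomial.C q.2))

/-- The (n-th generalized) Szőnyi complement: the quotient of the division of
`(x^p - x)^n` by the Rédei polynomial in `(F_p[y])[x]`. -/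
noncomputable def szonyi (p n : ℕ) (U : Finset (ZMod p × ZMod p)) :
    Polynomial (Polynomial (ZMod p)) :=
  ((Polynomial.X ^ p - Polynomial.X) ^ n) /ₘ redei p U

/-- The Rédei–Szőnyi polynomial `H_{U,n} = R_U · S_{U,n}`. -/
noncomputable def RS (p n : ℕ) (U : Finset (ZMod p × ZMod p)) :
    Polynomial (Polynomial (ZMod p)) :=
  redei p U * szonyi p n U

section Lacunary

/-- Modulo the `(M+1)`-st power of `X ^ p - X`, the power `X ^ (N * p)` reduces to a polynomial of
degree at most `M * p + (N - M)`. -/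
theorem exists_natDegree_le_dvd_X_pow_sub {K : Type*} [CommRing K] [Nontrivial K] {p : ℕ}
    (hp : 1 < p) {M N : ℕ} (h : M ≤ N) :
    ∃ r : K[X], r.natDegree ≤ M * p + (N - M) ∧
      (X ^ p - X : K[X]) ^ (M + 1) ∣ X ^ (N * p) - r := by
  have hdeg : (X ^ p - X : K[X]).natDegree ≤ p := by
    refine (natDegree_sub_le _ _).trans ?_
    simp only [natDegree_X_pow, natDegree_X]
    omega
  refine ⟨∑ i ∈ range (M + 1), (X ^ p - X) ^ i * X ^ (N - i) * (N.choose i : K[X]), ?_, ?_⟩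
  · refine natDegree_sum_le_of_forall_le _ _ fun i hi => ?_
    have hi : i ≤ M := by simpa [Nat.lt_succ_iff] using hi
    refine natDegree_mul_le.trans ?_
    rw [natDegree_natCast, add_zero]
    refine natDegree_mul_le.trans ?_
    rw [natDegree_X_pow]
    have h1 : ((X ^ p - X : K[X]) ^ i).natDegree ≤ i * p :=
      natDegree_pow_le.trans (Nat.mul_le_mul_left i hdeg)
    obtain ⟨d, rfl⟩ := Nat.exists_eq_add_of_le hi
    have h2 : d ≤ d * p := Nat.le_mul_of_pos_right d (by omega)
    rw [add_mul]
    omega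
  · have h1 : (X : K[X]) ^ (N * p) = ((X ^ p - X) + X) ^ N := by
      rw [sub_add_cancel, ← pow_mul, mul_comm]
    rw [h1, add_pow, ← Finset.sum_range_add_sum_Ico _ (Nat.succ_le_succ h), add_sub_cancel_left]
    refine Finset.dvd_sum fun i hi => ?_
    exact ((pow_dvd_pow _ (Finset.mem_Ico.1 hi).1).mul_right _).mul_right _

/-- If the `p`-adic blocks `g l` of a polynomial have small degree for `l < j`, and the polynomial
is divisible by a high power of `X ^ p - X`, then the next block `g j` has small degree too. -/
theorem natDegree_le_of_X_pow_sub_X_pow_dvd {K : Type*} [CommRing K] [Nontrivial K] {p : ℕ}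
    (hp : 1 < p) {n j b : ℕ} (hj : j ≤ n) (hb : b < p) (g : ℕ → K[X])
    (hlow : ∀ l < j, (g l).natDegree + (j - l) ≤ b)
    (hhigh : ∀ l, j ≤ l → l ≤ n → (g l).natDegree < p)
    (hdvd : (X ^ p - X : K[X]) ^ (n - j + 1) ∣ ∑ l ∈ range (n + 1), g l * X ^ ((n - l) * p)) :
    (g j).natDegree ≤ b := by
  have hmonic : (X ^ p - X : K[X]).Monic :=
    monic_X_pow_sub (by rw [degree_X]; exact_mod_cast hp)
  have hqdeg : (X ^ p - X : K[X]).natDegree = p := by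
    rw [natDegree_sub_eq_left_of_natDegree_lt] <;> simp [hp]
  have hr : ∀ l, ∃ r : K[X], l < j → r.natDegree ≤ (n - j) * p + b ∧
      (X ^ p - X : K[X]) ^ (n - j + 1) ∣ g l * X ^ ((n - l) * p) - r := by
    intro l
    by_cases hl : l < j
    · obtain ⟨r, hr1, hr2⟩ := exists_natDegree_le_dvd_X_pow_sub (K := K) hp
        (show n - j ≤ n - l by omega)
      refine ⟨g l * r, fun _ => ⟨?_, ?_⟩⟩
      · have h1 := hlow l hl
        have h2 := natDegree_mul_le (p := g l) (q := r)
        omega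
      · rw [← mul_sub]
        exact hr2.mul_left _
    · exact ⟨0, fun h => absurd h hl⟩
  choose r hr using hr
  rw [← Finset.sum_range_add_sum_Ico _ (show j ≤ n + 1 by omega)] at hdvd
  set B : K[X] := ∑ l ∈ Finset.Ico j (n + 1), g l * X ^ ((n - l) * p) with hB
  set Q : K[X] := ∑ l ∈ range j, r l with hQ
  have hQdeg : Q.natDegree ≤ (n - j) * p + b :=
    natDegree_sum_le_of_forall_le _ _ fun l hl => (hr l (Finset.mem_range.1 hl)).1
  have hBQ : (X ^ p - X : K[X]) ^ (n - j + 1) ∣ B + Q := by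
    have h1 : (X ^ p - X : K[X]) ^ (n - j + 1) ∣
        ∑ l ∈ range j, (g l * X ^ ((n - l) * p) - r l) :=
      Finset.dvd_sum fun l hl => (hr l (Finset.mem_range.1 hl)).2
    have h2 := dvd_sub hdvd h1
    rw [Finset.sum_sub_distrib] at h2
    convert h2 using 1
    ring
  have hterm : ∀ l ∈ Finset.Ico j (n + 1),
      (g l * X ^ ((n - l) * p)).natDegree < (n - l + 1) * p := fun l hl => by
    have h1 := Finset.mem_Ico.1 hl
    have h2 := hhigh l h1.1 (by omega)
    have h3 := natDegree_mul_le (p := g l) (q := X ^ ((n - l) * p))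
    rw [natDegree_X_pow] at h3
    rw [add_mul]
    omega
  have hBdeg : B.natDegree < (n - j + 1) * p := by
    refine lt_of_le_of_lt (natDegree_sum_le_of_forall_le (n := (n - j + 1) * p - 1) _ _
      fun l hl => ?_) (Nat.sub_lt (Nat.mul_pos (by omega) (by omega)) one_pos)
    have h1 := hterm l hl
    have h2 : (n - l + 1) * p ≤ (n - j + 1) * p :=
      Nat.mul_le_mul_right _ (by have := Finset.mem_Ico.1 hl; omega)
    omega
  have hzero : B + Q = 0 := by
    by_contra hne
    have h1 : (B + Q).natDegree < ((X ^ p - X : K[X]) ^ (n - j + 1)).natDegree := by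
      rw [hmonic.natDegree_pow, hqdeg]
      refine lt_of_le_of_lt (natDegree_add_le _ _) (max_lt hBdeg (lt_of_le_of_lt hQdeg ?_))
      rw [add_mul]
      omega
    exact (hmonic.pow _).not_dvd_of_natDegree_lt hne h1 hBQ
  refine natDegree_le_iff_coeff_eq_zero.2 fun k hk => ?_
  have h1 : (B + Q).coeff ((n - j) * p + k) = (g j).coeff k := by
    rw [coeff_add, coeff_eq_zero_of_natDegree_lt (p := Q) (by omega), add_zero, hB,
      finsetSum_coeff, Finset.sum_eq_single_of_mem j (Finset.mem_Ico.2 ⟨le_rfl, by omega⟩),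
      add_comm, coeff_mul_X_pow]
    intro l hl hlj
    refine coeff_eq_zero_of_natDegree_lt ((hterm l hl).trans_le ?_)
    have h2 : (n - l + 1) * p ≤ (n - j) * p :=
      Nat.mul_le_mul_right _ (by have := Finset.mem_Ico.1 hl; omega)
    omega
  rw [← h1, hzero, coeff_zero]

end Lacunary

section TotalDegree

/-- The total degree of a bivariate polynomial is at most `d`. -/
def TotalDegreeLE {K : Type*} [CommRing K] (d : ℕ) (f : K[X][X]) : Prop :=
  ∀ i j, d < i + j → (f.coeff i).coeff j = 0

variable {K : Type*} [CommRing K] {d e : ℕ} {f g : K[X][X]}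

theorem TotalDegreeLE.add (hf : TotalDegreeLE d f) (hg : TotalDegreeLE d g) :
    TotalDegreeLE d (f + g) := fun i j h => by
  rw [coeff_add, coeff_add, hf i j h, hg i j h, add_zero]

theorem TotalDegreeLE.sub (hf : TotalDegreeLE d f) (hg : TotalDegreeLE d g) :
    TotalDegreeLE d (f - g) := fun i j h => by
  rw [coeff_sub, coeff_sub, hf i j h, hg i j h, sub_zero]

theorem TotalDegreeLE.mul (hf : TotalDegreeLE d f) (hg : TotalDegreeLE e g) :
    TotalDegreeLE (d + e) (f * g) := fun i j h => by
  rw [coeff_mul, finsetSum_coeff]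
  refine Finset.sum_eq_zero fun u hu => ?_
  rw [coeff_mul]
  refine Finset.sum_eq_zero fun v hv => ?_
  rw [HasAntidiagonal.mem_antidiagonal] at hu hv
  by_cases h1 : d < u.1 + v.1
  · rw [hf _ _ h1, zero_mul]
  · rw [hg u.2 v.2 (by omega), mul_zero]

theorem totalDegreeLE_one : TotalDegreeLE 0 (1 : K[X][X]) := fun i j h => by
  rw [coeff_one]
  split_ifs
  · rw [coeff_one, if_neg (by omega)]
  · rw [coeff_zero]

theorem TotalDegreeLE.prod {ι : Type*} (s : Finset ι) {F : ι → K[X][X]}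
    (hF : ∀ i ∈ s, TotalDegreeLE 1 (F i)) : TotalDegreeLE s.card (∏ i ∈ s, F i) := by
  classical
  induction s using Finset.induction_on with
  | empty => simpa using totalDegreeLE_one
  | insert a s ha ih =>
    rw [Finset.prod_insert ha, Finset.card_insert_of_notMem ha, add_comm]
    exact (hF a (Finset.mem_insert_self a s)).mul
      (ih fun i hi => hF i (Finset.mem_insert_of_mem hi))

theorem totalDegreeLE_map_C (f : K[X]) : TotalDegreeLE f.natDegree (f.map C) := fun i j h => by
  rw [coeff_map, coeff_C]
  split_ifs
  · exact coeff_eq_zero_of_natDegree_lt (by omega)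
  · rfl

/-- Division by a monic polynomial whose total degree equals its degree in the main variable lowers
the total degree accordingly. -/
theorem TotalDegreeLE.exists_div [Nontrivial K] (hg : g.Monic)
    (hgd : TotalDegreeLE g.natDegree g) (d : ℕ) :
    ∀ N (f : K[X][X]), f.natDegree < N → TotalDegreeLE d f →
      ∃ q r, r + g * q = f ∧ r.degree < g.degree ∧ TotalDegreeLE (d - g.natDegree) q := by
  intro N
  induction N with
  | zero => intro f hf; omega
  | succ N ih =>
    intro f hfN hf
    by_cases hlt : f.degree < g.degree
    · exact ⟨0, f, by simp, hlt, fun i j _ => by simp⟩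
    have hf0 : f ≠ 0 := fun h => hlt (by
      rw [h, degree_zero, bot_lt_iff_ne_bot, Ne, degree_eq_bot]; exact hg.ne_zero)
    have hle : g.degree ≤ f.degree := not_lt.1 hlt
    have hlen : g.natDegree ≤ f.natDegree := natDegree_le_natDegree hle
    set t : K[X][X] := C f.leadingCoeff * X ^ (f.natDegree - g.natDegree) with ht
    have hfd : f.natDegree ≤ d := by
      by_contra hcon
      refine hf0 (leadingCoeff_eq_zero.1 (Polynomial.ext fun j => ?_))
      rw [coeff_zero]
      exact hf _ _ (by omega)
    have htd : TotalDegreeLE (d - g.natDegree) t := fun i j h => by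
      rw [ht, coeff_C_mul_X_pow]
      split_ifs with hi
      · exact hf _ _ (by omega)
      · rw [coeff_zero]
    have hgt : TotalDegreeLE d (g * t) := by
      have := hgd.mul htd
      rwa [Nat.add_sub_cancel' (hlen.trans hfd)] at this
    by_cases hz : f - g * t = 0
    · exact ⟨t, 0, by rw [zero_add]; exact (sub_eq_zero.1 hz).symm, by
        rw [degree_zero, bot_lt_iff_ne_bot, Ne, degree_eq_bot]; exact hg.ne_zero, htd⟩
    have hlt' : (f - g * t).degree < f.degree := by
      have := div_wf_lemma ⟨hle, hf0⟩ hg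
      exact this
    obtain ⟨q, r, h1, h2, h3⟩ := ih (f - g * t)
      (by have := natDegree_lt_natDegree hz hlt'; omega) (hf.sub hgt)
    exact ⟨q + t, r, by rw [mul_add, ← add_assoc, h1, sub_add_cancel], h2, h3.add htd⟩

theorem TotalDegreeLE.divByMonic [Nontrivial K] (hg : g.Monic)
    (hgd : TotalDegreeLE g.natDegree g) (hf : TotalDegreeLE d f) :
    TotalDegreeLE (d - g.natDegree) (f /ₘ g) := by
  obtain ⟨q, r, h1, h2, h3⟩ := TotalDegreeLE.exists_div hg hgd d _ f (Nat.lt_succ_self _) hf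
  rwa [(div_modByMonic_unique q r hg ⟨h1, h2⟩).1]

end TotalDegree

section ShiftSwap

/-- The automorphism `f(x, y) ↦ f(x, z + m)` with the roles of the variables exchanged: the result
is a polynomial in `z` with coefficients in `K[x]`. -/
noncomputable def shiftSwap {K : Type*} [CommRing K] (m : K) : K[X][X] →+* K[X][X] :=
  eval₂RingHom ((mapRingHom C).comp (taylorAlgHom m : K[X] →+* K[X])) (C X)

variable {K : Type*} [CommRing K] (m : K)

theorem shiftSwap_X : shiftSwap m X = C X := by
  simp [shiftSwap]

theorem shiftSwap_C (a : K[X]) : shiftSwap m (C a) = (taylor m a).map C := by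
  simp [shiftSwap]

theorem coeff_coeff_shiftSwap (f : K[X][X]) (s i : ℕ) :
    ((shiftSwap m f).coeff s).coeff i = (taylor m (f.coeff i)).coeff s := by
  induction f using Polynomial.induction_on' with
  | add f g hf hg => simp only [map_add, coeff_add, hf, hg]
  | monomial k a =>
    rw [← C_mul_X_pow_eq_monomial, map_mul, map_pow, shiftSwap_X, shiftSwap_C, ← C_pow,
      coeff_mul_C, coeff_map, coeff_C_mul_X_pow, coeff_C_mul_X_pow]
    split_ifs
    · rfl
    · simp

theorem natDegree_coeff_shiftSwap_le (f : K[X][X]) (s : ℕ) :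
    ((shiftSwap m f).coeff s).natDegree ≤ f.natDegree := by
  refine natDegree_le_iff_coeff_eq_zero.2 fun i hi => ?_
  rw [coeff_coeff_shiftSwap, coeff_eq_zero_of_natDegree_lt hi]
  simp

theorem coeff_zero_shiftSwap (f : K[X][X]) :
    (shiftSwap m f).coeff 0 = f.map (evalRingHom m) := by
  ext i
  rw [coeff_coeff_shiftSwap, taylor_coeff_zero, coeff_map, coe_evalRingHom]

/-- The polynomial `f` in the variable `z` lies in the `k`-th power of the ideal
generated by `z` and `w`. -/
def VanishesToOrder {A : Type*} [CommRing A] (w : A) (k : ℕ) (f : A[X]) : Prop :=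
  ∀ s, w ^ (k - s) ∣ f.coeff s

variable {A : Type*} [CommRing A] {w : A} {k l : ℕ} {f g : A[X]}

theorem VanishesToOrder.mul (hf : VanishesToOrder w k f) (hg : VanishesToOrder w l g) :
    VanishesToOrder w (k + l) (f * g) := fun s => by
  rw [coeff_mul]
  refine Finset.dvd_sum fun u hu => ?_
  rw [HasAntidiagonal.mem_antidiagonal] at hu
  refine (pow_dvd_pow w ?_).trans (pow_add w _ _ ▸ mul_dvd_mul (hf u.1) (hg u.2))
  omega

theorem vanishesToOrder_zero (f : A[X]) : VanishesToOrder w 0 f := fun s => by simp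

theorem VanishesToOrder.prod_card_filter {ι : Type*} (U : Finset ι) (F : ι → A[X])
    (P : ι → Prop) [DecidablePred P] (hF : ∀ i ∈ U, P i → VanishesToOrder w 1 (F i)) :
    VanishesToOrder w (U.filter P).card (∏ i ∈ U, F i) := by
  classical
  induction U using Finset.induction_on with
  | empty => simpa using vanishesToOrder_zero _
  | insert a s ha ih =>
    rw [Finset.prod_insert ha, Finset.filter_insert]
    have ih := ih fun i hi => hF i (Finset.mem_insert_of_mem hi)
    split_ifs with h
    · rw [Finset.card_insert_of_notMem (by simp [ha]), add_comm]
      exact (hF a (Finset.mem_insert_self a s) h).mul ih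
    · have := (vanishesToOrder_zero (w := w) (F a)).mul ih
      rwa [zero_add] at this

theorem vanishesToOrder_one_C_sub (a : A) : VanishesToOrder w 1 (C w - C a * X) := fun s => by
  rcases s with _ | s
  · simp
  · simp

theorem vanishesToOrder_one_of_dvd (h : w ∣ f.coeff 0) : VanishesToOrder w 1 f := fun s => by
  rcases s with _ | s
  · simpa using h
  · simp

end ShiftSwap

section Redei

variable (p : ℕ) (U : Finset (ZMod p × ZMod p))

/-- The multiplicity of `c` as a root of the specialisation of the Rédei polynomial at `y = m`. -/
noncomputable def lineCount (m c : ZMod p) : ℕ :=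
  (U.filter fun q => q.1 * m - q.2 = c).card

theorem card_lineWithSlope_inter [NeZero p] (m c : ZMod p) :
    (lineWithSlope p (some m) c ∩ U).card = lineCount p U m (-c) := by
  rw [lineCount]
  congr 1
  ext q
  simp only [lineWithSlope, Finset.mem_inter, Finset.mem_filter, Finset.mem_univ, true_and]
  rw [and_comm]
  refine and_congr_right fun _ => ⟨fun h => ?_, fun h => ?_⟩
  · rw [h]; ring
  · linear_combination -h

theorem shiftSwap_redei (m : ZMod p) :
    shiftSwap m (redei p U) = ∏ q ∈ U, (C (X - C (q.1 * m - q.2)) - C (C q.1) * X) := by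
  rw [redei, map_prod]
  refine Finset.prod_congr rfl fun q _ => ?_
  rw [map_add, map_sub, shiftSwap_X, shiftSwap_C, shiftSwap_C]
  simp only [taylor_mul, taylor_C, taylor_X, Polynomial.map_mul, Polynomial.map_add, map_C, map_X,
    C_sub, C_mul]
  ring

theorem map_eval_redei (m : ZMod p) :
    (redei p U).map (evalRingHom m) = ∏ q ∈ U, (X - C (q.1 * m - q.2)) := by
  rw [redei, Polynomial.map_prod]
  refine Finset.prod_congr rfl fun q _ => ?_
  simp
  ring

theorem redei_eq_prod :
    redei p U = ∏ q ∈ U, (X - C (C q.1 * X - C q.2)) := by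
  refine Finset.prod_congr rfl fun q _ => ?_
  rw [C_sub]
  ring

theorem redei_monic : (redei p U).Monic := by
  rw [redei_eq_prod]
  exact monic_prod_of_monic _ _ fun q _ => monic_X_sub_C _

theorem natDegree_redei [Fact p.Prime] : (redei p U).natDegree = U.card := by
  rw [redei_eq_prod, natDegree_prod_of_monic _ _ fun q _ => monic_X_sub_C _]
  simp only [natDegree_X_sub_C, Finset.sum_const, smul_eq_mul, mul_one]

theorem totalDegreeLE_redei : TotalDegreeLE U.card (redei p U) := by
  rw [redei]
  refine TotalDegreeLE.prod _ fun q _ i j h => ?_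
  rcases i with _ | _ | i
  · obtain ⟨j, rfl⟩ : ∃ k, j = k + 2 := ⟨j - 2, by omega⟩
    simp [coeff_X, coeff_C]
  · obtain ⟨j, rfl⟩ : ∃ k, j = k + 1 := ⟨j - 1, by omega⟩
    simp [coeff_X, coeff_one]
  · simp [coeff_X]

variable [Fact p.Prime]

theorem prod_X_sub_C_eq_X_pow_sub_X :
    ∏ c : ZMod p, (X - C c) = (X ^ p - X : (ZMod p)[X]) := by
  have hp : 1 < p := (Fact.out : p.Prime).one_lt
  have hmonic : (X ^ p - X : (ZMod p)[X]).Monic :=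
    monic_X_pow_sub (by rw [degree_X]; exact_mod_cast hp)
  have hroots : (X ^ p - X : (ZMod p)[X]).roots = Finset.univ.val := by
    have := FiniteField.roots_X_pow_card_sub_X (ZMod p)
    rwa [ZMod.card] at this
  have h := prod_multiset_X_sub_C_of_monic_of_roots_card_eq hmonic (by
    rw [hroots, FiniteField.X_pow_card_sub_X_natDegree_eq _ hp]
    simp [ZMod.card])
  rw [hroots] at h
  exact h

theorem map_eval_redei_eq_prod_pow (m : ZMod p) :
    (redei p U).map (evalRingHom m) = ∏ c : ZMod p, (X - C c) ^ lineCount p U m c := by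
  rw [map_eval_redei, ← Finset.prod_fiberwise U (fun q => q.1 * m - q.2)]
  refine Finset.prod_congr rfl fun c _ => ?_
  rw [Finset.prod_congr rfl fun q hq => by rw [(Finset.mem_filter.1 hq).2], Finset.prod_const]
  congr 1

theorem map_eval_redei_mul_szonyi {n : ℕ} {m : ZMod p} (h : ∀ c, lineCount p U m c ≤ n) :
    (redei p U).map (evalRingHom m) * (szonyi p n U).map (evalRingHom m) = (X ^ p - X) ^ n := by
  have hdvd : (redei p U).map (evalRingHom m) ∣ (X ^ p - X) ^ n := by
    rw [map_eval_redei_eq_prod_pow, ← prod_X_sub_C_eq_X_pow_sub_X, ← Finset.prod_pow]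
    exact Finset.prod_dvd_prod_of_dvd _ _ fun c _ => pow_dvd_pow _ (h c)
  have hmon := (redei_monic p U).map (evalRingHom m)
  rw [szonyi, map_divByMonic _ (redei_monic p U)]
  have h1 := modByMonic_add_div ((X ^ p - X : (ZMod p)[X]) ^ n)
    ((redei p U).map (evalRingHom m))
  rw [(modByMonic_eq_zero_iff_dvd hmon).2 hdvd, zero_add] at h1
  simpa using h1

theorem X_sub_C_pow_dvd_map_eval_szonyi {n : ℕ} {m : ZMod p} (h : ∀ c, lineCount p U m c ≤ n)
    (c : ZMod p) :
    (X - C c) ^ (n - lineCount p U m c) ∣ (szonyi p n U).map (evalRingHom m) := by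
  have h1 := map_eval_redei_mul_szonyi p U h
  rw [map_eval_redei_eq_prod_pow, ← prod_X_sub_C_eq_X_pow_sub_X,
    ← Finset.mul_prod_erase _ _ (Finset.mem_univ c), ← Finset.mul_prod_erase Finset.univ
      (fun c : ZMod p => (X - C c : (ZMod p)[X])) (Finset.mem_univ c), mul_pow] at h1
  have hcop : IsCoprime ((X - C c : (ZMod p)[X]) ^ (n - lineCount p U m c))
      (∏ c' ∈ Finset.univ.erase c, (X - C c') ^ lineCount p U m c') :=
    IsCoprime.prod_right fun c' hc' => IsCoprime.pow
      (pairwise_coprime_X_sub_C Function.injective_id (Finset.ne_of_mem_erase hc').symm)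
  have hne : ((X - C c : (ZMod p)[X]) ^ lineCount p U m c) ≠ 0 :=
    pow_ne_zero _ (X_sub_C_ne_zero c)
  refine hcop.dvd_of_dvd_mul_left ⟨(∏ c' ∈ Finset.univ.erase c, (X - C c')) ^ n,
    mul_left_cancel₀ hne ?_⟩
  rw [← mul_assoc, h1, ← mul_assoc, ← pow_add, Nat.add_sub_cancel' (h c)]

/-- In a non-rich direction the Rédei–Szőnyi polynomial specialises to `(X ^ p - X) ^ n`. -/
theorem coeff_zero_shiftSwap_RS {n : ℕ} {m : ZMod p} (h : ∀ c, lineCount p U m c ≤ n) :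
    (shiftSwap m (RS p n U)).coeff 0 = (X ^ p - X) ^ n := by
  rw [coeff_zero_shiftSwap, RS, Polynomial.map_mul, map_eval_redei_mul_szonyi p U h]

/-- In a non-special direction the Rédei–Szőnyi polynomial vanishes to high order. -/
theorem X_pow_sub_X_pow_dvd_coeff_shiftSwap_RS {n : ℕ} {m : ZMod p}
    (h : ∀ c, lineCount p U m c ≤ n) (h' : ∀ c, n ≤ lineCount p U m c + 1) (s : ℕ) :
    (X ^ p - X) ^ (n - s) ∣ (shiftSwap m (RS p n U)).coeff s := by
  rw [← prod_X_sub_C_eq_X_pow_sub_X, ← Finset.prod_pow]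
  refine Finset.prod_dvd_of_coprime (fun c _ c' _ hcc' =>
    (pairwise_coprime_X_sub_C Function.injective_id hcc').pow) fun c _ => ?_
  have hR : VanishesToOrder (X - C c) (lineCount p U m c) (shiftSwap m (redei p U)) := by
    rw [shiftSwap_redei, lineCount]
    refine VanishesToOrder.prod_card_filter _ _ _ fun q _ hq => ?_
    rw [hq]
    exact vanishesToOrder_one_C_sub _
  have hS : VanishesToOrder (X - C c) (n - lineCount p U m c) (shiftSwap m (szonyi p n U)) := by
    have h1 := X_sub_C_pow_dvd_map_eval_szonyi p U h c
    have h2 := h c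
    have h3 := h' c
    rcases Nat.eq_zero_or_pos (n - lineCount p U m c) with h0 | h0
    · rw [h0]
      exact vanishesToOrder_zero _
    · have h4 : n - lineCount p U m c = 1 := by omega
      rw [h4] at h1 ⊢
      rw [pow_one] at h1
      exact vanishesToOrder_one_of_dvd (by rwa [coeff_zero_shiftSwap])
  have h1 := hR.mul hS
  rw [Nat.add_sub_cancel' (h c), ← map_mul] at h1
  exact h1 s

theorem totalDegreeLE_RS {n : ℕ} (h : U.card ≤ n * p) : TotalDegreeLE (n * p) (RS p n U) := by
  have hp : 1 < p := (Fact.out : p.Prime).one_lt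
  have hf : TotalDegreeLE (n * p) ((X ^ p - X : (ZMod p)[X][X]) ^ n) := by
    have h1 := totalDegreeLE_map_C ((X ^ p - X : (ZMod p)[X]) ^ n)
    rw [natDegree_pow, FiniteField.X_pow_card_sub_X_natDegree_eq _ hp] at h1
    simpa using h1
  have hR := totalDegreeLE_redei p U
  rw [← natDegree_redei] at hR
  have h1 := hR.mul (TotalDegreeLE.divByMonic (redei_monic p U) hR hf)
  rwa [Nat.add_sub_cancel' (by rwa [natDegree_redei])] at h1

end Redei

section Directions

variable {p : ℕ} [Fact p.Prime] {U : Finset (ZMod p × ZMod p)} {n : ℕ} {m : ZMod p}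

theorem lineCount_le_of_not_isRichDir (h2 : U.card ≤ n * p) (hm : ¬IsRichDir p U (some m))
    (c : ZMod p) : lineCount p U m c ≤ n := by
  by_contra! hlt
  refine hm ⟨-c, ?_⟩
  rw [IsRich, card_lineWithSlope_inter, neg_neg]
  have hp : (0 : ℚ) < p := by exact_mod_cast (Fact.out : p.Prime).pos
  have h3 : (U.card : ℚ) / p ≤ n := (div_le_iff₀ hp).2 (by exact_mod_cast h2)
  have h4 : (n : ℚ) + 1 ≤ lineCount p U m c := by exact_mod_cast hlt
  linarith

theorem le_lineCount_of_not_isSpecialDir (h1 : (n - 1) * p < U.card)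
    (hm : ¬IsSpecialDir p U (some m)) (c : ZMod p) : n ≤ lineCount p U m c + 1 := by
  by_contra! hlt
  refine hm ⟨-c, Or.inr ?_⟩
  rw [IsPoor, card_lineWithSlope_inter, neg_neg]
  have hp : (0 : ℚ) < p := by exact_mod_cast (Fact.out : p.Prime).pos
  obtain ⟨k, rfl⟩ : ∃ k, n = k + 1 := ⟨n - 1, by omega⟩
  rw [Nat.add_sub_cancel] at h1
  have h3 : (k : ℚ) ≤ U.card / p := (le_div_iff₀ hp).2 (by exact_mod_cast h1.le)
  have h4 : (lineCount p U m c : ℚ) + 1 ≤ k := by exact_mod_cast (by omega)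
  linarith

theorem IsRichDir.isSpecialDir {m : Option (ZMod p)} (h : IsRichDir p U m) :
    IsSpecialDir p U m :=
  let ⟨c, hc⟩ := h
  ⟨c, Or.inl hc⟩

end Directions

/-- A polynomial vanishes if its prescribed orders of vanishing add up to more than its degree. -/
theorem eq_zero_of_natDegree_lt_sum_order {K : Type*} [Field K] [Fintype K] (f : K[X])
    (ord : K → ℕ) (hord : ∀ m, ∀ s < ord m, (taylor m f).coeff s = 0)
    (hdeg : f.natDegree < ∑ m, ord m) : f = 0 := by
  have hdvd : ∏ m, (X - C m) ^ ord m ∣ f := by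
    refine Finset.prod_dvd_of_coprime (fun c _ c' _ hcc' =>
      (pairwise_coprime_X_sub_C Function.injective_id hcc').pow) fun m _ => ?_
    have h1 := _root_.map_dvd (taylorAlgHom (-m)) (X_pow_dvd_iff.2 (hord m))
    simpa [taylor_taylor, sub_eq_add_neg] using h1
  have hmon : (∏ m, (X - C m) ^ ord m).Monic :=
    monic_prod_of_monic _ _ fun m _ => (monic_X_sub_C m).pow _
  by_contra hf
  refine hmon.not_dvd_of_natDegree_lt hf ?_ hdvd
  rw [natDegree_prod_of_monic _ _ fun m _ => (monic_X_sub_C m).pow _]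
  simpa using hdeg

theorem RS_is_lacunary (p n : ℕ) [Fact p.Prime]
    (U : Finset (ZMod p × ZMod p))
    (h1 : (n - 1) * p < U.card) (h2 : U.card ≤ n * p)
    (G : ℕ → Polynomial (Polynomial (ZMod p)))
    (hGdeg : ∀ j ∈ Finset.Icc 1 n, (G j).natDegree < p)
    (hH : RS p n U = Polynomial.X ^ (n * p)
        + ∑ j ∈ Finset.Icc 1 n, G j * Polynomial.X ^ ((n - j) * p)) :
    ∀ j ∈ Finset.Icc 1 n,
      (G j).natDegree
        ≤ max ({m : ZMod p | IsRichDir p U (some m)}.ncard) 1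
          + (j - 1) * max ({m : ZMod p | IsSpecialDir p U (some m)}.ncard) 1 := by
  have hp : 1 < p := (Fact.out : p.Prime).one_lt
  set E : Set (ZMod p) := {m | IsRichDir p U (some m)} with hE
  set D : Set (ZMod p) := {m | IsSpecialDir p U (some m)} with hD
  let g : ℕ → (ZMod p)[X][X] := fun l => if l = 0 then 1 else G l
  have hg0 : g 0 = 1 := if_pos rfl
  have hg : ∀ l, l ≠ 0 → g l = G l := fun l hl => if_neg hl
  have hgdeg : ∀ l ≤ n, (g l).natDegree < p := fun l hl => by
    rcases Nat.eq_zero_or_pos l with rfl | h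
    · rw [hg0, natDegree_one]; omega
    · rw [hg l h.ne']; exact hGdeg l (Finset.mem_Icc.2 ⟨h, hl⟩)
  have hHg : RS p n U = ∑ l ∈ range (n + 1), g l * X ^ ((n - l) * p) := by
    rw [hH, Finset.range_eq_Ico, Finset.sum_eq_sum_Ico_succ_bot (Nat.succ_pos n), hg0, one_mul,
      Nat.sub_zero]
    refine congrArg _ (Finset.sum_congr ?_ fun l hl => ?_)
    · ext l; simp only [Finset.mem_Icc, Finset.mem_Ico]; omega
    · rw [hg l (by have := Finset.mem_Icc.1 hl; omega)]
  have hcoeff : ∀ m s, (shiftSwap m (RS p n U)).coeff s =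
      ∑ l ∈ range (n + 1), (shiftSwap m (g l)).coeff s * X ^ ((n - l) * p) := fun m s => by
    rw [hHg, map_sum, finsetSum_coeff]
    refine Finset.sum_congr rfl fun l _ => ?_
    rw [map_mul, map_pow, shiftSwap_X, ← C_pow, coeff_mul_C]
  intro j
  induction j using Nat.strong_induction_on with
  | _ j ih =>
  intro hj
  have hj1 := (Finset.mem_Icc.1 hj).1
  have hjn := (Finset.mem_Icc.1 hj).2
  set b := max E.ncard 1 + (j - 1) * max D.ncard 1 with hb
  by_cases hbp : b < p
  swap
  · have := hGdeg j hj; omega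
  have hlow : ∀ l < j, (g l).natDegree + (j - l) ≤ b := fun l hl => by
    have hD1 : 1 ≤ max D.ncard 1 := le_max_right _ _
    have hE1 : 1 ≤ max E.ncard 1 := le_max_right _ _
    rcases Nat.eq_zero_or_pos l with rfl | h
    · rw [hg0, natDegree_one]
      have := Nat.le_mul_of_pos_right (j - 1) hD1
      omega
    · rw [hg l h.ne']
      have h3 := ih l hl (Finset.mem_Icc.2 ⟨h, by omega⟩)
      obtain ⟨d, rfl⟩ := Nat.exists_eq_add_of_lt hl
      obtain ⟨i, rfl⟩ := Nat.exists_eq_add_of_lt h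
      have := Nat.le_mul_of_pos_right (d + 1) hD1
      have h4 : 0 + i + 1 + d + 1 - 1 = (0 + i + 1 - 1) + (d + 1) := by omega
      rw [hb, h4, add_mul]
      omega
  have hlacunary : ∀ m s, (X ^ p - X) ^ (n - j + 1) ∣ (shiftSwap m (RS p n U)).coeff s →
      ((shiftSwap m (G j)).coeff s).natDegree ≤ b := fun m s hdvd => by
    rw [hcoeff] at hdvd
    have := natDegree_le_of_X_pow_sub_X_pow_dvd hp hjn hbp
      (fun l => (shiftSwap m (g l)).coeff s)
      (fun l hl => (Nat.add_le_add_right (natDegree_coeff_shiftSwap_le m _ s) _).trans (hlow l hl))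
      (fun l _ hl => (natDegree_coeff_shiftSwap_le m _ s).trans_lt (hgdeg l hl)) hdvd
    rwa [hg j (by omega)] at this
  let ord : ZMod p → ℕ := fun m => if m ∈ E then 0 else if m ∈ D then 1 else j
  have hord : ∀ m, ∀ s < ord m, ((shiftSwap m (G j)).coeff s).natDegree ≤ b := by
    intro m s hs
    apply hlacunary
    by_cases hmE : m ∈ E
    · simp [ord, hmE] at hs
    have hle := lineCount_le_of_not_isRichDir h2 hmE
    by_cases hmD : m ∈ D
    · obtain rfl : s = 0 := by simpa [ord, hmE, hmD] using hs
      rw [coeff_zero_shiftSwap_RS p U hle]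
      exact pow_dvd_pow _ (by omega)
    · have hs : s < j := by simpa [ord, hmE, hmD] using hs
      exact (pow_dvd_pow _ (by omega)).trans (X_pow_sub_X_pow_dvd_coeff_shiftSwap_RS p U hle
        (le_lineCount_of_not_isSpecialDir h1 hmD) s)
  have hsum : j * p ≤ ∑ m, ord m + (E.ncard + (j - 1) * D.ncard) := by
    have hcard : ∀ S : Set (ZMod p), S.ncard = ∑ m, if m ∈ S then 1 else 0 := fun S => by
      rw [Finset.sum_boole, Set.ncard_eq_toFinset_card' S, Nat.cast_id]
      congr 1
      ext m
      simp
    rw [hcard E, hcard D, Finset.mul_sum, ← Finset.sum_add_distrib, ← Finset.sum_add_distrib]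
    calc j * p = ∑ _m : ZMod p, j := by simp [ZMod.card, mul_comm]
      _ ≤ _ := Finset.sum_le_sum fun m _ => by
        by_cases hmE : m ∈ E
        · have hmD : m ∈ D := IsRichDir.isSpecialDir hmE
          simp only [ord, if_pos hmE, if_pos hmD]
          omega
        · by_cases hmD : m ∈ D
          · simp only [ord, if_neg hmE, if_pos hmD]
            omega
          · simp only [ord, if_neg hmE, if_neg hmD]
            omega
  refine natDegree_le_iff_coeff_eq_zero.2 fun k hk => ?_
  by_cases hkp : p ≤ k
  · exact coeff_eq_zero_of_natDegree_lt ((hGdeg j hj).trans_le hkp)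
  push Not at hkp
  refine eq_zero_of_natDegree_lt_sum_order _ ord (fun m s hs => ?_) ?_
  · rw [← coeff_coeff_shiftSwap]
    exact coeff_eq_zero_of_natDegree_lt ((hord m s hs).trans_lt hk)
  have hcoeffH : (RS p n U).coeff ((n - j) * p + k) = (G j).coeff k := by
    rw [hHg, finsetSum_coeff, Finset.sum_eq_single_of_mem j (Finset.mem_range.2 (by omega)),
      hg j (by omega), add_comm, coeff_mul_X_pow]
    intro l hl hlj
    have hln : l ≤ n := Nat.lt_succ_iff.1 (Finset.mem_range.1 hl)
    rw [coeff_mul_X_pow']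
    split_ifs with hle
    · refine coeff_eq_zero_of_natDegree_lt ((hgdeg l hln).trans_le ?_)
      rcases lt_or_gt_of_ne hlj with h | h
      · have := Nat.mul_le_mul_right p (show n - j + 1 ≤ n - l by omega)
        rw [add_mul] at this
        omega
      · have := Nat.mul_le_mul_right p (show n - l + 1 ≤ n - j by omega)
        rw [add_mul] at this
        omega
    · rfl
  have hdeg : ((G j).coeff k).natDegree ≤ j * p - k :=
    natDegree_le_iff_coeff_eq_zero.2 fun i hi => by
      rw [← hcoeffH]
      refine totalDegreeLE_RS p U h2 _ _ ?_
      have : n * p = (n - j) * p + j * p := by rw [← add_mul, Nat.sub_add_cancel hjn]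
      omega
  have h3 : E.ncard + (j - 1) * D.ncard ≤ b :=
    add_le_add (le_max_left _ _) (Nat.mul_le_mul_left _ (le_max_left _ _))
  have h4 : p ≤ j * p := Nat.le_mul_of_pos_left p hj1
  omega
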